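/- Let a : ℝ³ → ℝ³ be a differentiable vector field and let Anti(a) : ℝ³ → ℝ^{3×3} be the skew-symmetric matrix field Anti(a) = [[0, −a₃, a₂], [a₃, 0, −a₁], [−a₂, a₁, 0]] (so that axl(Anti a) = a). Define the row-wise matrix curl of a matrix field M by (Curl M)_{ij} := Σ_{k,l} ε_{jkl} ∂M_{il}/∂x_k, with ε the Levi-Civita symbol. Then, at every point, (Curl(Anti a))_{ij} = δ_{ij}·(div a) − ∂a_j/∂x_i for all i, j; equivalently, −Curl(Anti a) = (Da)ᵀ − tr(Da)·I, where Da is the Jacobian matrix (Da)_{ij} = ∂a_i/∂x_j and I the identity matrix. -/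

import Mathlib

open Matrix

noncomputable section

/-- Partial derivative of a scalar field on `ℝ³` in the `i`-th coordinate direction. -/
noncomputable def pd (i : Fin 3) (f : (Fin 3 → ℝ) → ℝ) (x : Fin 3 → ℝ) : ℝ :=
  fderiv ℝ f x (Pi.single i 1)

/-- Jacobian matrix of a vector field: `(Da)_{ij} = ∂a_i/∂x_j`. -/
noncomputable def jac (a : (Fin 3 → ℝ) → Fin 3 → ℝ) (x : Fin 3 → ℝ) :
    Matrix (Fin 3) (Fin 3) ℝ :=
  Matrix.of fun i j => pd j (fun y => a y i) x

/-- Levi-Civita symbol on `Fin 3`. -/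
def eps (i j k : Fin 3) : ℝ :=
  if (i, j, k) = ((0 : Fin 3), (1 : Fin 3), (2 : Fin 3)) ∨
      (i, j, k) = ((1 : Fin 3), (2 : Fin 3), (0 : Fin 3)) ∨
      (i, j, k) = ((2 : Fin 3), (0 : Fin 3), (1 : Fin 3)) then 1
  else if (i, j, k) = ((2 : Fin 3), (1 : Fin 3), (0 : Fin 3)) ∨
      (i, j, k) = ((0 : Fin 3), (2 : Fin 3), (1 : Fin 3)) ∨
      (i, j, k) = ((1 : Fin 3), (0 : Fin 3), (2 : Fin 3)) then -1
  else 0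

/-- Row-wise matrix curl: `(Curl M)_{ij} = Σ_{k,l} ε_{jkl} ∂M_{il}/∂x_k`. -/
noncomputable def curlM (M : (Fin 3 → ℝ) → Matrix (Fin 3) (Fin 3) ℝ) (x : Fin 3 → ℝ) :
    Matrix (Fin 3) (Fin 3) ℝ :=
  Matrix.of fun i j => ∑ k, ∑ l, eps j k l * pd k (fun y => M y i l) x

theorem pd_neg_aux (k : Fin 3) (f : (Fin 3 → ℝ) → ℝ) (x : Fin 3 → ℝ) :
    pd k (fun y => -f y) x = -pd k f x := by
  simp [pd, fderiv_fun_neg]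

theorem pd_zero_aux (k : Fin 3) (x : Fin 3 → ℝ) :
    pd k (fun _ => (0 : ℝ)) x = 0 := by
  simp [pd]

/-- Nye's relation: for a differentiable vector field `a` with skew-symmetric matrix
field `Anti(a)`, one has `(Curl(Anti a))_{ij} = δ_{ij} div a − ∂a_j/∂x_i`, i.e.
`−Curl(Anti a) = (Da)ᵀ − tr(Da)·I`. -/
theorem nye_relation (a : (Fin 3 → ℝ) → Fin 3 → ℝ) (ha : Differentiable ℝ a)
    (A : (Fin 3 → ℝ) → Matrix (Fin 3) (Fin 3) ℝ)
    (hA : A = fun x => !![0, -a x 2, a x 1; a x 2, 0, -a x 0; -a x 1, a x 0, 0]) :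
    (∀ (x : Fin 3 → ℝ) (i j : Fin 3),
      curlM A x i j =
        (if i = j then ∑ k, pd k (fun y => a y k) x else 0) - pd i (fun y => a y j) x) ∧
    (∀ x : Fin 3 → ℝ,
      -(curlM A x) =
        (jac a x)ᵀ - (Matrix.trace (jac a x)) • (1 : Matrix (Fin 3) (Fin 3) ℝ)) := by
  have h1 : ∀ (x : Fin 3 → ℝ) (i j : Fin 3),
      curlM A x i j =
        (if i = j then ∑ k, pd k (fun y => a y k) x else 0) - pd i (fun y => a y j) x := by
    intro x i j
    subst hA
    fin_cases i <;> fin_cases j <;>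
      simp [curlM, Fin.sum_univ_three, eps, pd_neg_aux, pd_zero_aux] <;> ring
  refine ⟨h1, fun x => ?_⟩
  ext i j
  rw [Matrix.neg_apply, h1]
  by_cases hij : i = j
  · subst hij
    simp [jac, Matrix.trace]
  · simp [jac, hij]
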